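/- With G, d, T, gᵢ as in the context, the element T(T(T(T(g₀, g₁, g₆), g₆, g₂), g₃, g₄), g₆, g₅) of G is nonzero. (This is the algebra counterpart of the statement that the associator ((((x,y,a),a,z),t,v),a,w), in which the argument a appears three times, is nontrivial in the free commutative Moufang loop of exponent 3 on seven generators, so the Triple Argument Hypothesis fails for n = 7.) -/

import Mathlib

/-- The Grassmann (exterior) algebra over `𝔽₃` of the free module with basis
indexed by `ℕ × ℕ`. -/
abbrev Gr : Type := ExteriorAlgebra (ZMod 3) ((ℕ × ℕ) →₀ ZMod 3)

/-- The generator `i^{(j)}` of the Grassmann algebra, i.e. `ι(e_{i,j})`. -/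
noncomputable abbrev gen (i j : ℕ) : Gr :=
  ExteriorAlgebra.ι (ZMod 3) (Finsupp.single (i, j) (1 : ZMod 3))

/-- `gᵢ = ι(e_{i,0})`. -/
noncomputable abbrev g (i : ℕ) : Gr := gen i 0

/-- Distinct generators multiply to a nonzero element. -/
lemma ExteriorAlgebra.ιMulti_single_ne_zero {R I : Type*} [CommRing R] [Nontrivial R] {n : ℕ}
    (k : Fin n → I) (hk : Function.Injective k) :
    ExteriorAlgebra.ιMulti R n (fun m => Finsupp.single (k m) (1 : R)) ≠ 0 := by
  classical
  intro h
  let D : (I →₀ R) [⋀^Fin n]→ₗ[R] R :=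
    Matrix.detRowAlternating.compLinearMap
      (LinearMap.pi fun m : Fin n => Finsupp.lapply (k m))
  have h1 := congrArg (ExteriorAlgebra.liftAlternating (R := R)
    (Pi.single (M := fun i => (I →₀ R) [⋀^Fin i]→ₗ[R] R) n D)) h
  rw [ExteriorAlgebra.liftAlternating_apply_ιMulti, Pi.single_eq_same, map_zero] at h1
  have h2 : D (fun m => Finsupp.single (k m) (1 : R)) = (1 : Matrix (Fin n) (Fin n) R).det := by
    change Matrix.det _ = _
    congr 1
    ext a b
    simp [Finsupp.single_apply, Matrix.one_apply, hk.eq_iff]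
  rw [h2, Matrix.det_one] at h1
  exact one_ne_zero h1

lemma gen_sq (i j : ℕ) : gen i j * gen i j = 0 := ExteriorAlgebra.ι_sq_zero _

lemma gen_mul_comm (i j k l : ℕ) : gen i j * gen k l = -(gen k l * gen i j) :=
  eq_neg_of_add_eq_zero_left (ExteriorAlgebra.ι_add_mul_swap _ _)

/-- The endomorphism of `Gr` killing `gen i (j + 1)` for `i ≠ 6` and fixing the other generators. -/
noncomputable def killDerivs : Gr →ₐ[ZMod 3] Gr :=
  ExteriorAlgebra.map (Finsupp.linearCombination (ZMod 3) fun p : ℕ × ℕ =>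
    if p.1 = 6 ∨ p.2 = 0 then Finsupp.single p (1 : ZMod 3) else 0)

lemma killDerivs_gen (i j : ℕ) :
    killDerivs (gen i j) = if i = 6 ∨ j = 0 then gen i j else 0 := by
  simp only [killDerivs, gen, ExteriorAlgebra.map_apply_ι, Finsupp.linearCombination_single,
    one_smul]
  split_ifs <;> simp

/-- The kernel of `killDerivs` is stable under `d`. -/
lemma killDerivs_d {d : Gr →ₗ[ZMod 3] Gr}
    (hLeib : ∀ u v : Gr, d (u * v) = d u * v + u * d v)
    (hd : ∀ i j : ℕ, d (gen i j) = gen i (j + 1)) (x : Gr) :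
    killDerivs (d (killDerivs x)) = killDerivs (d x) := by
  have d_one : d 1 = 0 := by simpa using hLeib 1 1
  have idem : ∀ y, killDerivs (killDerivs y) = killDerivs y := by
    intro y
    have : killDerivs.comp killDerivs = killDerivs := by
      apply ExteriorAlgebra.hom_ext
      apply Finsupp.lhom_ext'
      rintro ⟨i, j⟩
      ext
      change killDerivs (killDerivs (gen i j)) = killDerivs (gen i j)
      simp only [killDerivs_gen]
      split_ifs with h <;> simp [killDerivs_gen, h]
    exact DFunLike.congr_fun this y
  induction x using ExteriorAlgebra.induction with
  | algebraMap r => simp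
  | ι v =>
    induction v using Finsupp.induction_linear with
    | zero => simp
    | add u v hu hv => simp only [map_add, hu, hv]
    | single p r =>
      obtain ⟨i, j⟩ := p
      have : ExteriorAlgebra.ι (ZMod 3) (Finsupp.single (i, j) r) = r • gen i j := by
        rw [← map_smul, Finsupp.smul_single, smul_eq_mul, mul_one]
      rw [this]
      simp only [map_smul, killDerivs_gen, hd]
      split_ifs with h <;> simp_all [killDerivs_gen]
  | mul a b ha hb => simp only [map_mul, hLeib, map_add, ha, hb, idem]
  | add a b ha hb => simp only [map_add, ha, hb]

/-- with `T x y z = -d (x*y*z)`, the element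
`T(T(T(T(g₀,g₁,g₆),g₆,g₂),g₃,g₄),g₆,g₅)` is nonzero.  (Algebra counterpart of
the failure of the Triple Argument Hypothesis for `n = 7`.) -/
theorem stmt_12 (d : Gr →ₗ[ZMod 3] Gr)
    (hLeib : ∀ u v : Gr, d (u * v) = d u * v + u * d v)
    (hd : ∀ i j : ℕ, d (gen i j) = gen i (j + 1)) :
    (fun x y z : Gr => -d (x * y * z))
      ((fun x y z : Gr => -d (x * y * z))
        ((fun x y z : Gr => -d (x * y * z))
          ((fun x y z : Gr => -d (x * y * z)) (g 0) (g 1) (g 6)) (g 6) (g 2))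
        (g 3) (g 4)) (g 6) (g 5) ≠ 0 := by
  have sq : ∀ (j : ℕ) (x : Gr), gen 6 j * (gen 6 j * x) = 0 := fun j x => by
    rw [← mul_assoc, gen_sq, zero_mul]
  have swap : ∀ (i j k l : ℕ) (x : Gr),
      gen i j * (gen k l * x) = -(gen k l * (gen i j * x)) := fun i j k l x => by
    rw [← mul_assoc, gen_mul_comm, neg_mul, mul_assoc]
  have step : ∀ x x' : Gr, killDerivs x = killDerivs x' → ∀ i j : ℕ,
      killDerivs (-d (x * g i * g j)) = killDerivs (-d (x' * g i * g j)) := by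
    intro x x' h i j
    rw [map_neg, map_neg, ← killDerivs_d hLeib hd, ← killDerivs_d hLeib hd (x' * _ * _)]
    simp only [map_mul, h]
  have e₁ : killDerivs (-d (g 0 * g 1 * g 6)) =
      killDerivs (-(gen 0 0 * gen 1 0 * gen 6 1)) := by
    simp [hLeib, hd, killDerivs_gen]
  have e₂ : killDerivs (-d (-(gen 0 0 * gen 1 0 * gen 6 1) * g 6 * g 2)) =
      killDerivs (gen 0 0 * gen 1 0 * gen 6 2 * gen 6 0 * gen 2 0) := by
    simp [hLeib, hd, killDerivs_gen, mul_assoc, mul_add, sq]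
  have e₃ : killDerivs (-d (gen 0 0 * gen 1 0 * gen 6 2 * gen 6 0 * gen 2 0 * g 3 * g 4)) =
      killDerivs (-(gen 0 0 * gen 1 0 * (gen 6 3 * gen 6 0 + gen 6 2 * gen 6 1) *
        gen 2 0 * gen 3 0 * gen 4 0)) := by
    simp [hLeib, hd, killDerivs_gen, mul_assoc, add_mul, mul_add]
  have e₄ : killDerivs (-d (-(gen 0 0 * gen 1 0 * (gen 6 3 * gen 6 0 + gen 6 2 * gen 6 1) *
        gen 2 0 * gen 3 0 * gen 4 0) * g 6 * g 5)) =
      -(gen 0 0 * (gen 1 0 * (gen 6 3 * (gen 6 1 * (gen 6 0 * (gen 2 0 * (gen 3 0 *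
        (gen 4 0 * gen 5 0)))))))) := by
    simp [hLeib, hd, killDerivs_gen, mul_assoc, add_mul, mul_add, sq, swap 4 0 6, swap 3 0 6,
      swap 2 0 6]
  intro h
  have h0 := congrArg killDerivs h
  rw [step _ _ ((step _ _ ((step _ _ e₁ 6 2).trans e₂) 3 4).trans e₃) 6 5, e₄, map_zero,
    neg_eq_zero] at h0
  refine ExteriorAlgebra.ιMulti_single_ne_zero (R := ZMod 3)
    ![((0 : ℕ), (0 : ℕ)), (1, 0), (6, 3), (6, 1), (6, 0), (2, 0), (3, 0), (4, 0), (5, 0)]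
    (by decide) ?_
  rw [ExteriorAlgebra.ιMulti_apply]
  simpa [List.ofFn_succ] using h0
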